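/- arXiv:2512.17688 — 3 statements merged into one kernel-verified Lean document; each statement's English description precedes it below -/
import Mathlib

section
/- Let τ be a random variable taking values in ℕ on a probability space, and let m ≥ 1 be an integer such that P(τ > h) ≤ (1/4)^{⌊h/m⌋} for every h ∈ ℕ. Then τ² is integrable and E[τ²] ≤ 20m²/9. -/
open MeasureTheory

lemma aux_inner (a : ℝ) (m : ℕ) :
    ∑ i ∈ Finset.range m, (2 * (a + (i : ℝ)) + 1) = 2 * a * m + m ^ 2 := by
  induction m with
  | zero => simp
  | succ n ih => rw [Finset.sum_range_succ, ih]; push_cast; ring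

lemma aux_block (m : ℕ) (hm : 1 ≤ m) (K : ℕ) :
    ∑ h ∈ Finset.range (K * m), (2 * (h : ℝ) + 1) * (1 / 4 : ℝ) ^ (h / m)
      = m ^ 2 * (20 / 9 - (8 / 3 * K + 20 / 9) * (1 / 4 : ℝ) ^ K) := by
  induction K with
  | zero => simp
  | succ K ih =>
    rw [Nat.succ_mul, Finset.sum_range_add, ih]
    have : ∑ i ∈ Finset.range m,
        (2 * ((K * m + i : ℕ) : ℝ) + 1) * (1 / 4 : ℝ) ^ ((K * m + i) / m)
        = (2 * (K * m : ℝ) * m + m ^ 2) * (1 / 4 : ℝ) ^ K := by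
      rw [← aux_inner, Finset.sum_mul]
      refine Finset.sum_congr rfl fun i hi => ?_
      have h1 : (K * m + i) / m = K := by
        rw [mul_comm, Nat.mul_add_div (by omega), Nat.div_eq_of_lt (Finset.mem_range.1 hi)]
        simp
      rw [h1]; push_cast; ring
    rw [this, pow_succ]; push_cast; ring

lemma aux_partial (m : ℕ) (hm : 1 ≤ m) (n : ℕ) :
    ∑ h ∈ Finset.range n, (2 * (h : ℝ) + 1) * (1 / 4 : ℝ) ^ (h / m) ≤ 20 * m ^ 2 / 9 := by
  calc _ ≤ ∑ h ∈ Finset.range (n * m), (2 * (h : ℝ) + 1) * (1 / 4 : ℝ) ^ (h / m) := by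
        apply Finset.sum_le_sum_of_subset_of_nonneg
        · exact Finset.range_mono (Nat.le_mul_of_pos_right n hm)
        · intros; positivity
    _ ≤ _ := by
        rw [aux_block m hm]
        have : (0 : ℝ) ≤ m ^ 2 * ((8 / 3 * n + 20 / 9) * (1 / 4 : ℝ) ^ n) := by positivity
        linarith

lemma aux_pt (t : ℕ) : ENNReal.ofReal ((t : ℝ) ^ 2)
    = ∑' h : ℕ, (if h < t then ENNReal.ofReal (2 * (h : ℝ) + 1) else 0) := by
  rw [tsum_eq_sum (s := Finset.range t) (fun b hb => if_neg (by simpa using hb)),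
    Finset.sum_congr rfl (fun b hb => if_pos (Finset.mem_range.1 hb)),
    ← ENNReal.ofReal_sum_of_nonneg (fun i _ => by positivity)]
  have := aux_inner 0 t
  simp only [zero_add] at this
  rw [this]; simp

lemma aux_lint {Ω : Type*} [MeasurableSpace Ω] (μ : Measure Ω)
    (τ : Ω → ℕ) (hτ : Measurable τ) (m : ℕ) (hm : 1 ≤ m)
    (htail : ∀ h : ℕ, μ {ω | h < τ ω} ≤ ENNReal.ofReal ((1 / 4 : ℝ) ^ (h / m))) :
    ∫⁻ ω, ENNReal.ofReal ((τ ω : ℝ) ^ 2) ∂μ ≤ ENNReal.ofReal (20 * m ^ 2 / 9) := by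
  have hs : ∀ h : ℕ, MeasurableSet {ω | h < τ ω} := fun h => hτ (measurableSet_Ioi (a := h))
  simp_rw [aux_pt]
  rw [lintegral_tsum (fun h => (Measurable.ite (hs h) measurable_const
    measurable_const).aemeasurable)]
  have h1 : ∀ h : ℕ, ∫⁻ ω, (if h < τ ω then ENNReal.ofReal (2 * (h : ℝ) + 1) else 0) ∂μ
      ≤ ENNReal.ofReal ((2 * (h : ℝ) + 1) * (1 / 4 : ℝ) ^ (h / m)) := by
    intro h
    have := lintegral_indicator_const (μ := μ) (hs h) (ENNReal.ofReal (2 * (h : ℝ) + 1))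
    simp only [Set.indicator_apply, Set.mem_setOf_eq] at this
    rw [this, ENNReal.ofReal_mul (by positivity)]
    gcongr
    exact htail h
  refine (ENNReal.tsum_le_tsum h1).trans (ENNReal.tsum_le_of_sum_range_le fun n => ?_)
  rw [← ENNReal.ofReal_sum_of_nonneg (fun i _ => by positivity)]
  exact ENNReal.ofReal_le_ofReal (aux_partial m hm n)

/-- Second coupling-time bound: `E[τ²] ≤ 20m²/9` under geometric tails. -/
theorem stmt5 {Ω : Type*} [MeasurableSpace Ω] (μ : Measure Ω) [IsProbabilityMeasure μ]
    (τ : Ω → ℕ) (hτ : Measurable τ) (m : ℕ) (hm : 1 ≤ m)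
    (htail : ∀ h : ℕ, μ {ω | h < τ ω} ≤ ENNReal.ofReal ((1 / 4 : ℝ) ^ (h / m))) :
    Integrable (fun ω => (τ ω : ℝ) ^ 2) μ ∧ ∫ ω, (τ ω : ℝ) ^ 2 ∂μ ≤ 20 * m ^ 2 / 9 := by
  have hl := aux_lint μ τ hτ m hm htail
  have hmeas : Measurable (fun ω => (τ ω : ℝ) ^ 2) :=
    (measurable_from_nat (f := fun n : ℕ => (n : ℝ) ^ 2)).comp hτ
  have hnn : 0 ≤ᵐ[μ] (fun ω => (τ ω : ℝ) ^ 2) := Filter.Eventually.of_forall fun ω => by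
    simp only [Pi.zero_apply]; positivity
  refine ⟨⟨hmeas.aestronglyMeasurable, ?_⟩, ?_⟩
  · rw [hasFiniteIntegral_iff_ofReal hnn]
    exact hl.trans_lt ENNReal.ofReal_lt_top
  · rw [integral_eq_lintegral_of_nonneg_ae hnn hmeas.aestronglyMeasurable]
    exact ENNReal.toReal_le_of_le_ofReal (by positivity) hl
end

section
/- Let N ≥ 1, let H ≥ 1 be an integer, let η ≥ 0, and for each c ∈ {1,…,N} let A_c be a linear endomorphism of ℝ^d with ‖(I + ηA_c) x‖ ≤ ‖x‖ for all x ∈ ℝ^d, and let v_c ∈ ℝ^d. Set Ā = (1/N) Σ_{c=1}^N A_c and assume Σ_{c=1}^N A_c v_c = 0. Then ‖(1/N) Σ_{c=1}^N (I − (I + ηA_c)^H) v_c‖² ≤ (η⁴ H² (H−1)² / 4) · ((1/N) Σ_{c=1}^N ‖A_c − Ā‖²) · ((1/N) Σ_{c=1}^N ‖A_c v_c‖²), where ‖A_c − Ā‖ denotes the operator norm. -/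
theorem aux_pow_contr {E : Type*} [NormedAddCommGroup E] [NormedSpace ℝ E] (b : E →L[ℝ] E)
    (hb : ∀ x, ‖b x‖ ≤ ‖x‖) (h : ℕ) (x : E) : ‖(b ^ h) x‖ ≤ ‖x‖ := by
  induction h with
  | zero => simp
  | succ k ih =>
    rw [pow_succ', ContinuousLinearMap.mul_apply]
    exact (hb _).trans ih

theorem aux_pow_sub {E : Type*} [NormedAddCommGroup E] [NormedSpace ℝ E] (a b : E →L[ℝ] E)
    (ha : ∀ x, ‖a x‖ ≤ ‖x‖) (hb : ∀ x, ‖b x‖ ≤ ‖x‖) (h : ℕ) (x : E) :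
    ‖(a ^ h) x - (b ^ h) x‖ ≤ h * (‖a - b‖ * ‖x‖) := by
  induction h with
  | zero => simp
  | succ k ih =>
    have e : (a ^ (k+1)) x - (b ^ (k+1)) x
        = a ((a ^ k) x - (b ^ k) x) + (a - b) ((b ^ k) x) := by
      simp only [pow_succ', ContinuousLinearMap.mul_apply, map_sub, ContinuousLinearMap.sub_apply]
      abel
    rw [e]
    have h1 := ha ((a ^ k) x - (b ^ k) x)
    have h2 := (a - b).le_opNorm ((b ^ k) x)
    have h3 := mul_le_mul_of_nonneg_left (aux_pow_contr b hb k x) (norm_nonneg (a - b))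
    have h4 := norm_add_le (a ((a ^ k) x - (b ^ k) x)) ((a - b) ((b ^ k) x))
    rw [Nat.cast_succ]
    linarith

theorem aux_tele {E : Type*} [NormedAddCommGroup E] [NormedSpace ℝ E] (A : E →L[ℝ] E)
    (η : ℝ) (H : ℕ) (v : E) :
    ((1 : E →L[ℝ] E) - (1 + η • A) ^ H) v
      = -(η • ∑ h ∈ Finset.range H, ((1 + η • A) ^ h) (A v)) := by
  induction H with
  | zero => simp
  | succ k ih =>
    rw [Finset.sum_range_succ, smul_add, neg_add, ← ih, pow_succ]
    simp only [ContinuousLinearMap.sub_apply, ContinuousLinearMap.mul_apply,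
      ContinuousLinearMap.add_apply, ContinuousLinearMap.smul_apply,
      ContinuousLinearMap.one_apply, map_add, map_smul]
    abel

theorem aux_sum_range (H : ℕ) : ∑ h ∈ Finset.range H, (h : ℝ) = H * ((H : ℝ) - 1) / 2 := by
  induction H with
  | zero => simp
  | succ k ih => rw [Finset.sum_range_succ, ih]; push_cast; ring


/-- Refined bound on the heterogeneity bias `Δ_{1:H}` (Lemma `bound-drift-one-round`). -/
theorem stmt16 (d N : ℕ) (hN : 1 ≤ N) (H : ℕ) (hH : 1 ≤ H) (η : ℝ) (hη : 0 ≤ η)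
    (A : Fin N → (EuclideanSpace ℝ (Fin d) →L[ℝ] EuclideanSpace ℝ (Fin d)))
    (hcontr : ∀ c x, ‖(1 + η • A c) x‖ ≤ ‖x‖)
    (v : Fin N → EuclideanSpace ℝ (Fin d))
    (hfix : ∑ c, A c (v c) = 0) :
    ‖(N : ℝ)⁻¹ • ∑ c, (((1 : EuclideanSpace ℝ (Fin d) →L[ℝ] EuclideanSpace ℝ (Fin d))
        - (1 + η • A c) ^ H) (v c))‖ ^ 2
      ≤ (η ^ 4 * (H : ℝ) ^ 2 * ((H : ℝ) - 1) ^ 2 / 4)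
          * ((N : ℝ)⁻¹ * ∑ c, ‖A c - (N : ℝ)⁻¹ • ∑ c', A c'‖ ^ 2)
          * ((N : ℝ)⁻¹ * ∑ c, ‖A c (v c)‖ ^ 2) := by
  set Ab := (N : ℝ)⁻¹ • ∑ c', A c' with hAb
  have hN0 : (0 : ℝ) < N := by exact_mod_cast hN
  have hbar : ∀ x, ‖(1 + η • Ab) x‖ ≤ ‖x‖ := by
    intro x
    have e : (1 + η • Ab) x = (N : ℝ)⁻¹ • ∑ c, (1 + η • A c) x := by
      simp only [hAb, ContinuousLinearMap.add_apply, ContinuousLinearMap.smul_apply,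
        ContinuousLinearMap.one_apply, ContinuousLinearMap.sum_apply, Finset.sum_add_distrib,
        Finset.sum_const, Finset.card_univ, Fintype.card_fin, smul_add, ← Finset.smul_sum]
      rw [← Nat.cast_smul_eq_nsmul ℝ, inv_smul_smul₀ hN0.ne',
        smul_comm]
    rw [e, norm_smul, Real.norm_of_nonneg (by positivity)]
    have h1 : ‖∑ c, (1 + η • A c) x‖ ≤ N * ‖x‖ := by
      refine (norm_sum_le_of_le _ (fun c _ => hcontr c x)).trans ?_
      simp
    calc (N : ℝ)⁻¹ * _ ≤ (N : ℝ)⁻¹ * (N * ‖x‖) := by gcongr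
      _ = ‖x‖ := by field_simp
  set T : ℝ := ∑ c, ‖A c - Ab‖ * ‖A c (v c)‖ with hT
  have hstep : ∀ h : ℕ, ‖∑ c, ((1 + η • A c) ^ h) (A c (v c))‖ ≤ h * (η * T) := by
    intro h
    have e : ∑ c, ((1 + η • A c) ^ h) (A c (v c))
        = ∑ c, (((1 + η • A c) ^ h) (A c (v c)) - ((1 + η • Ab) ^ h) (A c (v c))) := by
      rw [Finset.sum_sub_distrib, ← map_sum, hfix, map_zero, sub_zero]
    rw [e, hT, Finset.mul_sum, Finset.mul_sum]
    refine norm_sum_le_of_le _ (fun c _ => ?_)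
    refine (aux_pow_sub _ _ (hcontr c) hbar h _).trans (le_of_eq ?_)
    have : (1 + η • A c) - (1 + η • Ab) = η • (A c - Ab) := by
      rw [smul_sub]; abel
    rw [this, norm_smul, Real.norm_of_nonneg hη]
    ring
  have hmain : ‖(N : ℝ)⁻¹ • ∑ c, (((1 : EuclideanSpace ℝ (Fin d) →L[ℝ] EuclideanSpace ℝ (Fin d))
        - (1 + η • A c) ^ H) (v c))‖ ≤ (N : ℝ)⁻¹ * (η * ((H * ((H : ℝ) - 1) / 2) * (η * T))) := by
    rw [norm_smul, Real.norm_of_nonneg (by positivity : (0 : ℝ) ≤ (N : ℝ)⁻¹)]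
    simp only [aux_tele]
    rw [Finset.sum_neg_distrib, norm_neg, ← Finset.smul_sum, norm_smul, Real.norm_of_nonneg hη,
      Finset.sum_comm, ← aux_sum_range, Finset.sum_mul]
    gcongr
    exact norm_sum_le_of_le _ (fun h _ => hstep h)
  have hcs : T ^ 2 ≤ (∑ c, ‖A c - Ab‖ ^ 2) * ∑ c, ‖A c (v c)‖ ^ 2 :=
    Finset.sum_mul_sq_le_sq_mul_sq _ _ _
  calc _ ≤ ((N : ℝ)⁻¹ * (η * ((H * ((H : ℝ) - 1) / 2) * (η * T)))) ^ 2 := by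
        gcongr
    _ = (η ^ 4 * (H : ℝ) ^ 2 * ((H : ℝ) - 1) ^ 2 / 4) * ((N : ℝ)⁻¹) ^ 2 * T ^ 2 := by ring
    _ ≤ (η ^ 4 * (H : ℝ) ^ 2 * ((H : ℝ) - 1) ^ 2 / 4) * ((N : ℝ)⁻¹) ^ 2 *
        ((∑ c, ‖A c - Ab‖ ^ 2) * ∑ c, ‖A c (v c)‖ ^ 2) := by gcongr
    _ = _ := by ring
end

section
/- Let N ≥ 1, let s_1, …, s_N : ℝ^d → ℝ^d be continuous maps, and suppose there exist η > 0, ξ ∈ (0,1) and R̄ ≥ 0 such that ‖θ + η s_c(θ)‖ ≤ ξ‖θ‖ + (1+ξ)R̄ for every c ∈ {1,…,N} and every θ ∈ ℝ^d. Then there exists θ* ∈ ℝ^d with ‖θ*‖ ≤ (1+ξ)R̄/(1−ξ) and Σ_{c=1}^N s_c(θ*) = 0. -/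
open MeasureTheory Metric Set

theorem bw_poly (d : ℕ) (A : EuclideanSpace ℝ (Fin d) →L[ℝ] EuclideanSpace ℝ (Fin d)) :
    ∃ p : Polynomial ℝ, p.degree < ((d + 1 : ℕ) : WithBot ℕ) ∧
      ∀ t : ℝ, p.eval t = (1 + t • A).det := by
  let b := (EuclideanSpace.basisFun (Fin d) ℝ).toBasis
  let M := LinearMap.toMatrix b b (A : EuclideanSpace ℝ (Fin d) →ₗ[ℝ] EuclideanSpace ℝ (Fin d))
  refine ⟨Matrix.det ((Polynomial.X : Polynomial ℝ) • M.map Polynomial.C +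
    (1 : Matrix (Fin d) (Fin d) ℝ).map Polynomial.C), ?_, ?_⟩
  · have h := Polynomial.natDegree_det_X_add_C_le M 1
    rw [Fintype.card_fin] at h
    refine lt_of_le_of_lt (Polynomial.natDegree_le_iff_degree_le.1 h) ?_
    exact_mod_cast Nat.lt_succ_self d
  · intro t
    rw [ContinuousLinearMap.det, ← LinearMap.det_toMatrix b, ← Polynomial.coe_evalRingHom, RingHom.map_det]
    congr 1
    have : (((1 + t • A : EuclideanSpace ℝ (Fin d) →L[ℝ] EuclideanSpace ℝ (Fin d))) :
      EuclideanSpace ℝ (Fin d) →ₗ[ℝ] EuclideanSpace ℝ (Fin d)) = LinearMap.id + t • (A : EuclideanSpace ℝ (Fin d) →ₗ[ℝ] EuclideanSpace ℝ (Fin d)) := rfl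
    rw [this, map_add (LinearMap.toMatrix b b), map_smul (LinearMap.toMatrix b b), LinearMap.toMatrix_id]
    ext i j
    by_cases hij : i = j <;> simp [M, hij] <;> ring

theorem bw_interp (d : ℕ) (ε : ℝ) (hε : 0 < ε) :
    ∃ w t : ℕ → ℝ, (∀ i ∈ Finset.range (d+1), 0 < t i ∧ t i < ε) ∧ ∑ i ∈ Finset.range (d+1), w i = 1 ∧
      ∀ A : EuclideanSpace ℝ (Fin d) →L[ℝ] EuclideanSpace ℝ (Fin d),
        (1 + A).det = ∑ i ∈ Finset.range (d+1), w i * (1 + t i • A).det := by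
  let t : ℕ → ℝ := fun i => ε / (i + 2)
  have hinj : Set.InjOn t (Finset.range (d+1)) := by
    intro i _ j _ h
    simp only [t] at h
    have h1 : (0:ℝ) < i + 2 := by positivity
    have h2 : (0:ℝ) < j + 2 := by positivity
    field_simp at h
    have : (i:ℝ) = j := by linarith
    exact_mod_cast this
  refine ⟨fun i => (Lagrange.basis (Finset.range (d+1)) t i).eval 1, t, ?_, ?_, ?_⟩
  · intro i _
    refine ⟨by positivity, ?_⟩
    simp only [t]
    rw [div_lt_iff₀ (by positivity)]
    nlinarith [(Nat.cast_nonneg i : (0:ℝ) ≤ i)]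
  · rw [← Polynomial.eval_finsetSum, Lagrange.sum_basis hinj (by simp)]
    simp
  · intro A
    obtain ⟨p, hp, hpt⟩ := bw_poly d A
    have h := Lagrange.eq_interpolate (s := Finset.range (d+1)) (v := t) hinj (f := p) (by simpa using hp)
    have h1 := hpt 1
    rw [one_smul] at h1
    rw [← h1]
    conv_lhs => rw [h]
    rw [Lagrange.interpolate_apply, Polynomial.eval_finsetSum]
    refine Finset.sum_congr rfl fun i _ => ?_
    simp [hpt, mul_comm]

theorem bw_det_pos {E : Type*} [NormedAddCommGroup E] [InnerProductSpace ℝ E] [FiniteDimensional ℝ E]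
    (A : E →L[ℝ] E) (hA : ‖A‖ < 1) : 0 < (1 + A).det := by
  have hne : ∀ s ∈ Icc (0:ℝ) 1, (1 + s • A).det ≠ 0 := by
    intro s hs h0
    have hn : ‖-(s • A)‖ < 1 := by
      rw [norm_neg, norm_smul, Real.norm_of_nonneg hs.1]
      nlinarith [hs.1, hs.2, norm_nonneg A]
    have hu := isUnit_one_sub_of_norm_lt_one hn
    rw [sub_neg_eq_add] at hu
    have h2 : IsUnit (LinearMap.det ((1 + s • A : E →L[ℝ] E) : E →ₗ[ℝ] E)) := by
      obtain ⟨u, hu⟩ := hu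
      have := hu ▸ u.isUnit.map (ContinuousLinearMap.toLinearMapRingHom : (E →L[ℝ] E) →+* (E →ₗ[ℝ] E))
      exact this.map LinearMap.det
    exact h2.ne_zero h0
  by_contra hle
  push Not at hle
  have hc : ContinuousOn (fun s : ℝ => (1 + s • A).det) (Icc 0 1) :=
    (ContinuousLinearMap.continuous_det.comp (by fun_prop)).continuousOn
  have := intermediate_value_Icc' (zero_le_one) hc (show (0:ℝ) ∈ _ by
    refine ⟨by simpa using hle, ?_⟩
    simp [ContinuousLinearMap.det])
  obtain ⟨s, hs, h⟩ := this
  exact hne s hs h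

theorem bw_ext {E : Type*} [NormedAddCommGroup E] [InnerProductSpace ℝ E]
    (a : ℝ) (h : E → E) (K : NNReal) (hK : LipschitzOnWith K h (closedBall 0 a))
    (h0 : ∀ x, ‖x‖ = a → h x = 0) :
    ∃ H : E → E, LipschitzWith K H ∧ (∀ x, ‖x‖ ≤ a → H x = h x) ∧ ∀ x, a < ‖x‖ → H x = 0 := by
  classical
  have key : ∀ x y : E, ‖x‖ ≤ a → a < ‖y‖ → ‖h x‖ ≤ K * dist x y := by
    intro x y hx hy
    have hc : ContinuousOn (fun s : ℝ => ‖AffineMap.lineMap (k := ℝ) x y s‖) (Icc 0 1) := by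
      apply Continuous.continuousOn
      exact continuous_norm.comp AffineMap.lineMap_continuous
    obtain ⟨s, hs, hsa⟩ := intermediate_value_Icc zero_le_one hc (show a ∈ _ by
      simpa using ⟨hx, hy.le⟩)
    simp only at hsa
    have h1 := hK.dist_le_mul x (by simpa using hx) (AffineMap.lineMap (k := ℝ) x y s)
      (by simpa using hsa.le)
    rw [h0 _ hsa, dist_zero_right, dist_left_lineMap, Real.norm_of_nonneg hs.1] at h1
    refine h1.trans ?_
    gcongr
    have := dist_nonneg (x := x) (y := y)
    nlinarith [hs.2]
  refine ⟨fun x => if ‖x‖ ≤ a then h x else 0, ?_, ?_, ?_⟩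
  · refine LipschitzWith.of_dist_le_mul fun x y => ?_
    by_cases hx : ‖x‖ ≤ a <;> by_cases hy : ‖y‖ ≤ a
    · simp only [hx, hy, if_true]
      exact hK.dist_le_mul x (by simpa using hx) y (by simpa using hy)
    · simpa only [hx, hy, if_true, if_false, dist_zero_right] using key x y hx (not_le.1 hy)
    · simpa only [hx, hy, if_true, if_false, dist_zero_left, dist_comm x y] using key y x hy (not_le.1 hx)
    · simp only [hx, hy, if_false, dist_self]
      positivity
  · intro x hx
    simp [hx]
  · intro x hx
    simp [not_le.2 hx]

theorem bw_image {E : Type*} [NormedAddCommGroup E] [InnerProductSpace ℝ E] [CompleteSpace E]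
    (a : ℝ) (h : E → E) (K : NNReal) (hK : LipschitzOnWith K h (closedBall 0 a))
    (h0 : ∀ x, ‖x‖ = a → h x = 0) (hr : ∀ x, ‖x‖ ≤ a → ‖x + h x‖ = a)
    (t : NNReal) (htK : t * K < 1) (ht1 : t ≤ 1) :
    InjOn (fun x => x + (t:ℝ) • h x) (closedBall 0 a) ∧
      (fun x => x + (t:ℝ) • h x) '' (closedBall 0 a) = closedBall 0 a := by
  have ht1' : (t:ℝ) ≤ 1 := by exact_mod_cast ht1
  have htK' : (t:ℝ) * K < 1 := by exact_mod_cast htK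
  constructor
  · intro x hx y hy hxy
    simp only at hxy
    have h1 := hK.dist_le_mul x hx y hy
    rw [dist_eq_norm, dist_eq_norm] at h1
    have h2 : x - y = (t:ℝ) • (h y - h x) := by
      rw [smul_sub, sub_eq_sub_iff_add_eq_add, hxy, add_comm]
    have h3 : ‖x - y‖ ≤ t * (K * ‖x - y‖) := by
      conv_lhs => rw [h2]
      rw [norm_smul, Real.norm_of_nonneg t.coe_nonneg, norm_sub_rev]
      gcongr
    have h4 : ‖x - y‖ ≤ 0 := by
      by_contra hc
      push Not at hc
      nlinarith
    exact sub_eq_zero.1 (norm_le_zero_iff.1 h4)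
  · apply Subset.antisymm
    · rintro _ ⟨x, hx, rfl⟩
      have hx' : ‖x‖ ≤ a := by simpa using hx
      have h1 : x + (t:ℝ) • h x = (1 - (t:ℝ)) • x + (t:ℝ) • (x + h x) := by module
      rw [mem_closedBall_zero_iff]
      simp only
      rw [h1]
      refine (norm_add_le _ _).trans ?_
      rw [norm_smul, norm_smul, hr x hx', Real.norm_of_nonneg t.coe_nonneg, Real.norm_of_nonneg (by linarith)]
      nlinarith
    · intro y hy
      obtain ⟨H, HL, H1, H2⟩ := bw_ext a h K hK h0
      have hc : ContractingWith (t * K) (fun x => y - (t:ℝ) • H x) := by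
        refine ⟨htK, LipschitzWith.of_dist_le_mul fun x z => ?_⟩
        rw [dist_sub_left, dist_smul₀, Real.norm_of_nonneg t.coe_nonneg]
        push_cast
        rw [mul_assoc]
        gcongr
        exact HL.dist_le_mul x z
      have hf := hc.fixedPoint_isFixedPt
      set x := hc.fixedPoint
      have hx : y - (t:ℝ) • H x = x := hf
      have hy' : ‖y‖ ≤ a := by simpa using hy
      have hxa : ‖x‖ ≤ a := by
        by_contra hxa
        push Not at hxa
        rw [H2 x hxa] at hx
        simp at hx
        rw [← hx] at hxa
        linarith
      refine ⟨x, by simpa using hxa, ?_⟩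
      simp only
      rw [← H1 x hxa]
      nth_rewrite 1 [← hx]
      abel

theorem bw_noretract (d : ℕ) (a : ℝ) (ha : 0 < a) (U : Set (EuclideanSpace ℝ (Fin d)))
    (hUo : IsOpen U) (hU : closedBall 0 a ⊆ U)
    (h : EuclideanSpace ℝ (Fin d) → EuclideanSpace ℝ (Fin d)) (hh : ContDiffOn ℝ 1 h U)
    (h0 : ∀ x, ‖x‖ = a → h x = 0) (hr : ∀ x, ‖x‖ ≤ a → ‖x + h x‖ = a) : False := by
  set B := closedBall (0 : EuclideanSpace ℝ (Fin d)) a with hB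
  have hBc : IsCompact B := isCompact_closedBall _ _
  have hcont : ContinuousOn (fderiv ℝ h) B := (hh.continuousOn_fderiv_of_isOpen hUo le_rfl).mono hU
  have hder : ∀ x ∈ B, HasFDerivAt h (fderiv ℝ h x) x := fun x hx =>
    ((hh.differentiableOn one_ne_zero).differentiableAt (hUo.mem_nhds (hU hx))).hasFDerivAt
  obtain ⟨C, hC⟩ := hBc.exists_bound_of_continuousOn hcont
  set K : NNReal := C.toNNReal with hKdef
  have hCK : ∀ x ∈ B, ‖fderiv ℝ h x‖ ≤ K := fun x hx => (hC x hx).trans (Real.le_coe_toNNReal C)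
  have hK : LipschitzOnWith K h B := (convex_closedBall _ _).lipschitzOnWith_of_nnnorm_hasFDerivWithin_le
    (fun x hx => (hder x hx).hasFDerivWithinAt) (fun x hx => hCK x hx)
  have hKp : (0:ℝ) < K + 1 := by positivity
  have hdc : ∀ t : ℝ, ContinuousOn (fun x => (1 + t • fderiv ℝ h x).det) B := fun t =>
    ContinuousLinearMap.continuous_det.comp_continuousOn
      (continuousOn_const.add (hcont.const_smul t))
  obtain ⟨w, t, ht, hw, hdet⟩ := bw_interp d (1 / (K + 1)) (by positivity)
  have hint : ∀ i ∈ Finset.range (d+1),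
      ∫ x in B, (1 + t i • fderiv ℝ h x).det = volume.real B := by
    intro i hi
    obtain ⟨ht0, hte⟩ := ht i hi
    rw [lt_div_iff₀ hKp] at hte
    have hK0 : (0:ℝ) ≤ K := K.2
    have htK : t i * K < 1 := by nlinarith
    have ht1 : t i ≤ 1 := by nlinarith
    lift t i to NNReal using ht0.le with τ hτ
    obtain ⟨hinj, him⟩ := bw_image a h K hK h0 hr τ (by exact_mod_cast htK) (by exact_mod_cast ht1)
    have hcv := integral_image_eq_integral_abs_det_fderiv_smul (volume)
      (s := B) (f := fun x => x + (τ:ℝ) • h x) (f' := fun x => 1 + (τ:ℝ) • fderiv ℝ h x)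
      measurableSet_closedBall
      (fun x hx => ((hasFDerivAt_id x).add ((hder x hx).const_smul (τ:ℝ))).hasFDerivWithinAt)
      hinj (fun _ => (1:ℝ))
    rw [him] at hcv
    simp only [smul_eq_mul, mul_one] at hcv
    rw [setIntegral_const, smul_eq_mul, mul_one] at hcv
    rw [hcv]
    refine setIntegral_congr_fun measurableSet_closedBall fun x hx => ?_
    refine (abs_of_pos (bw_det_pos _ ?_)).symm
    rw [norm_smul, Real.norm_of_nonneg ht0.le]
    exact lt_of_le_of_lt (mul_le_mul_of_nonneg_left (hCK x hx) ht0.le) htK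
  have hone : ∫ x in B, (1 + fderiv ℝ h x).det = volume.real B := by
    rw [integral_congr_ae (Filter.Eventually.of_forall fun x => hdet (fderiv ℝ h x)), integral_finsetSum]
    · simp_rw [integral_const_mul]
      rw [Finset.sum_congr rfl fun i hi => by rw [hint i hi], ← Finset.sum_mul, hw, one_mul]
    · intro i _
      exact ((hdc (t i)).integrableOn_compact hBc).const_mul _
  have hzero : ∀ x ∈ B, (1 + fderiv ℝ h x).det = 0 := by
    intro x hx
    by_contra hne
    have hud : UniqueDiffWithinAt ℝ B x := uniqueDiffOn_convex (convex_closedBall _ _)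
      (by rw [interior_closedBall _ ha.ne']; exact ⟨0, by simpa using ha⟩) x hx
    have hd : HasFDerivWithinAt (fun x => x + h x) (1 + fderiv ℝ h x) B x :=
      ((hasFDerivAt_id x).add (hder x hx)).hasFDerivWithinAt
    have hd2 := hd.norm_sq
    have hd3 : HasFDerivWithinAt (fun x => ‖x + h x‖ ^ 2)
        (0 : EuclideanSpace ℝ (Fin d) →L[ℝ] ℝ) B x :=
      (hasFDerivWithinAt_const (a ^ 2) x B).congr (fun y hy => by rw [hr y (by simpa [hB] using hy)])
        (by rw [hr x (by simpa [hB] using hx)])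
    have heq := hud.eq hd2 hd3
    have hs : Function.Surjective (fun v => (1 + fderiv ℝ h x : EuclideanSpace ℝ (Fin d) →L[ℝ] EuclideanSpace ℝ (Fin d)) v) := by
      have := (LinearMap.equivOfDetNeZero _ hne).surjective
      exact this
    obtain ⟨v, hv⟩ := hs (x + h x)
    have h4 : 2 * inner ℝ (x + h x)
        ((1 + fderiv ℝ h x : EuclideanSpace ℝ (Fin d) →L[ℝ] EuclideanSpace ℝ (Fin d)) v) = (0:ℝ) := by
      have := congrArg (fun L => L v) heq
      rw [two_smul] at this
      rw [two_mul]
      exact this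
    simp only at hv
    rw [hv, real_inner_self_eq_norm_sq, hr x (by simpa [hB] using hx)] at h4
    have : 0 < a ^ 2 := by positivity
    linarith
  rw [setIntegral_congr_fun measurableSet_closedBall hzero] at hone
  simp at hone
  have : 0 < volume.real B :=
    ENNReal.toReal_pos (measure_closedBall_pos volume _ ha).ne' hBc.measure_lt_top.ne
  linarith

theorem bw_smooth (d : ℕ) (a : ℝ) (ha : 0 < a)
    (g : EuclideanSpace ℝ (Fin d) → EuclideanSpace ℝ (Fin d)) (hg : ContDiff ℝ 1 g)
    (hga : ∀ x, ‖x‖ ≤ a → ‖g x‖ < a) : ∃ x, ‖x‖ ≤ a ∧ g x = x := by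
  by_contra hno
  push Not at hno
  let u : EuclideanSpace ℝ (Fin d) → EuclideanSpace ℝ (Fin d) := fun x => x - g x
  let p : EuclideanSpace ℝ (Fin d) → ℝ := fun x => inner ℝ x (u x)
  let D : EuclideanSpace ℝ (Fin d) → ℝ := fun x => p x ^ 2 + ‖u x‖ ^ 2 * (a ^ 2 - ‖x‖ ^ 2)
  have hu : ContDiff ℝ 1 u := contDiff_id.sub hg
  have hp : ContDiff ℝ 1 p := contDiff_id.inner ℝ hu
  have hn : ContDiff ℝ 1 (fun x => ‖u x‖ ^ 2) := hu.norm_sq ℝ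
  have hD : ContDiff ℝ 1 D :=
    (hp.pow 2).add (hn.mul (contDiff_const.sub (contDiff_id.norm_sq ℝ)))
  have hu0 : ∀ x, ‖x‖ ≤ a → u x ≠ 0 := fun x hx h => hno x hx (sub_eq_zero.1 h).symm
  have hpp : ∀ x, ‖x‖ = a → 0 < p x := by
    intro x hx
    have h1 : p x = ‖x‖ ^ 2 - inner ℝ x (g x) := by
      simp only [p, u, inner_sub_right, real_inner_self_eq_norm_sq]
    have h2 := real_inner_le_norm x (g x)
    have h3 := hga x hx.le
    rw [hx] at h1 h2
    nlinarith
  have hDpos : ∀ x, ‖x‖ ≤ a → 0 < D x := by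
    intro x hx
    have hnp : 0 < ‖u x‖ ^ 2 := by
      have := norm_pos_iff.2 (hu0 x hx)
      positivity
    rcases hx.lt_or_eq with hlt | heq
    · have : 0 < a ^ 2 - ‖x‖ ^ 2 := by nlinarith [norm_nonneg x]
      have := mul_pos hnp this
      simp only [D]
      nlinarith [sq_nonneg (p x)]
    · have := hpp x heq
      simp only [D, heq, sub_self, mul_zero, add_zero]
      positivity
  refine bw_noretract d a ha ({x | 0 < D x} ∩ {x | u x ≠ 0})
    ((isOpen_lt continuous_const hD.continuous).inter (isOpen_ne_fun hu.continuous continuous_const))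
    (fun x hx => ⟨hDpos x (by simpa using hx), hu0 x (by simpa using hx)⟩)
    (fun x => ((-p x + Real.sqrt (D x)) / ‖u x‖ ^ 2) • u x) ?_ ?_ ?_
  · refine ContDiffOn.smul (ContDiffOn.div (hp.neg.contDiffOn.add
      (hD.contDiffOn.sqrt fun x hx => (ne_of_gt hx.1))) hn.contDiffOn fun x hx => ?_) hu.contDiffOn
    have : ‖u x‖ ≠ 0 := norm_ne_zero_iff.2 hx.2
    exact pow_ne_zero 2 this
  · intro x hx
    have : D x = p x ^ 2 := by simp [D, hx]
    rw [this, Real.sqrt_sq (hpp x hx).le]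
    simp
  · intro x hx
    have hnp : 0 < ‖u x‖ ^ 2 := by
      have := norm_pos_iff.2 (hu0 x hx)
      positivity
    have hs := Real.sq_sqrt (hDpos x hx).le
    have hsq : ‖x + ((-p x + Real.sqrt (D x)) / ‖u x‖ ^ 2) • u x‖ ^ 2 = a ^ 2 := by
      rw [norm_add_sq_real, norm_smul, mul_pow, Real.norm_eq_abs, sq_abs, inner_smul_right]
      change ‖x‖ ^ 2 + 2 * (_ * p x) + _ = _
      generalize Real.sqrt (D x) = s at hs
      simp only [D] at hs
      generalize ‖u x‖ ^ 2 = n at *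
      field_simp
      linarith
    exact (pow_left_inj₀ (norm_nonneg _) ha.le two_ne_zero).1 hsq

/-- Existence of the FedSARSA limit point via Brouwer's fixed-point theorem. -/
theorem stmt17 (d N : ℕ) (hN : 1 ≤ N)
    (s : Fin N → EuclideanSpace ℝ (Fin d) → EuclideanSpace ℝ (Fin d))
    (hs : ∀ c, Continuous (s c))
    (η ξ R : ℝ) (hη : 0 < η) (hξ0 : 0 < ξ) (hξ1 : ξ < 1) (hR : 0 ≤ R)
    (hgrowth : ∀ c θ, ‖θ + η • s c θ‖ ≤ ξ * ‖θ‖ + (1 + ξ) * R) :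
    ∃ θstar : EuclideanSpace ℝ (Fin d),
      ‖θstar‖ ≤ (1 + ξ) * R / (1 - ξ) ∧ ∑ c, s c θstar = 0 := by
  have hNp : (0:ℝ) < N := by exact_mod_cast hN
  have hξ : 0 < 1 - ξ := by linarith
  let F : EuclideanSpace ℝ (Fin d) → EuclideanSpace ℝ (Fin d) :=
    fun θ => (N:ℝ)⁻¹ • ∑ c, (θ + η • s c θ)
  have hFc : Continuous F := by
    have : Continuous fun θ => ∑ c, (θ + η • s c θ) :=
      continuous_finsetSum _ fun c _ => continuous_id.add ((hs c).const_smul η)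
    exact this.const_smul (N:ℝ)⁻¹
  have hFg : ∀ θ, ‖F θ‖ ≤ ξ * ‖θ‖ + (1 + ξ) * R := by
    intro θ
    simp only [F]
    rw [norm_smul, norm_inv, Real.norm_of_nonneg hNp.le, inv_mul_le_iff₀ hNp]
    refine (norm_sum_le _ _).trans ((Finset.sum_le_sum fun c _ => hgrowth c θ).trans ?_)
    simp [mul_add]
  set ρ := (1 + ξ) * R / (1 - ξ) with hρ
  have hρ0 : 0 ≤ ρ := by positivity
  have hρe : (1 + ξ) * R = (1 - ξ) * ρ := by rw [hρ]; field_simp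
  obtain ⟨θ, hθ, hmin⟩ := (isCompact_closedBall (0 : EuclideanSpace ℝ (Fin d)) (ρ + 1)).exists_isMinOn
    ⟨0, by simp; linarith⟩ (f := fun x => ‖F x - x‖) (by fun_prop)
  have hfix : F θ = θ := by
    by_contra hne
    have hm : 0 < ‖F θ - θ‖ := norm_pos_iff.2 (sub_ne_zero.2 hne)
    obtain ⟨g, hg, hgF, -⟩ := hFc.exists_contDiff_approx 1 (ε := fun _ => min (‖F θ - θ‖) (1 - ξ))
      continuous_const (fun _ => lt_min hm hξ)
    obtain ⟨x, hx, hgx⟩ := bw_smooth d (ρ + 1) (by linarith) g hg (by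
      intro x hx
      have h1 := (hgF x).trans_le (min_le_right _ _)
      rw [dist_eq_norm] at h1
      have h2 := norm_le_norm_add_norm_sub (F x) (g x)
      rw [norm_sub_rev] at h2
      have h3 := hFg x
      rw [norm_sub_rev] at h1
      have h4 := norm_le_norm_add_norm_sub (F x) (g x)
      nlinarith)
    have h1 := (hgF x).trans_le (min_le_left _ _)
    have h2 : ‖F θ - θ‖ ≤ ‖F x - x‖ := hmin (by simpa using hx)
    rw [hgx, dist_comm, dist_eq_norm] at h1
    linarith
  refine ⟨θ, ?_, ?_⟩
  · have := hFg θ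
    rw [hfix] at this
    nlinarith
  · simp only [F] at hfix
    rw [inv_smul_eq_iff₀ hNp.ne', Finset.sum_add_distrib, ← Finset.smul_sum] at hfix
    simp only [Finset.sum_const, Finset.card_univ, Fintype.card_fin, ← Nat.cast_smul_eq_nsmul ℝ] at hfix
    have := add_eq_left.1 hfix
    exact (smul_eq_zero.1 this).resolve_left hη.ne'
end
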